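/- arXiv:1910.08202 — 3 statements merged into one kernel-verified Lean document; each statement's English description precedes it below -/
import Mathlib

section
/- For 0 < d < 1, the sequence r_t(d) = ∑_{j=0}^{t-1} π_j(d) satisfies r_t(d) ~ t^{-d}/Γ(1-d) as t → ∞, i.e., the ratio r_t(d)·Γ(1-d)·t^{d} converges to 1. -/
open Filter Finset MeasureTheory ProbabilityTheory Real

/-- Fractional-differencing coefficients: `π_0(d) = 1`,
`π_j(d) = π_{j-1}(d)·(j-1-d)/j` for `j ≥ 1`. -/
noncomputable def fracCoef (d : ℝ) : ℕ → ℝ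
  | 0 => 1
  | j + 1 => fracCoef d j * (((j : ℝ) - d) / ((j : ℝ) + 1))

/-- Partial sums `r_t(d) = ∑_{j=0}^{t-1} π_j(d)`. -/
noncomputable def rSum (d : ℝ) (t : ℕ) : ℝ := ∑ j ∈ Finset.range t, fracCoef d j

theorem natCast_mul_fracCoef (d : ℝ) (t : ℕ) : (t : ℝ) * fracCoef d t = -d * rSum d t := by
  induction t with
  | zero => simp [rSum]
  | succ n ih =>
    have hn : (n : ℝ) + 1 ≠ 0 := by positivity
    have hs : rSum d (n + 1) = rSum d n + fracCoef d n := Finset.sum_range_succ _ _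
    have hf : ((n : ℝ) + 1) * fracCoef d (n + 1) = fracCoef d n * ((n : ℝ) - d) := by
      rw [fracCoef]
      field_simp
    push_cast
    rw [hf, hs]
    linear_combination ih

theorem rSum_succ_mul_factorial (d : ℝ) (n : ℕ) :
    rSum d (n + 1) * (n.factorial : ℝ) = ∏ j ∈ Finset.range n, (1 - d + j) := by
  induction n with
  | zero => simp [rSum, fracCoef]
  | succ n ih =>
    have hs : rSum d (n + 2) = rSum d (n + 1) + fracCoef d (n + 1) := Finset.sum_range_succ _ _
    have hc := natCast_mul_fracCoef d (n + 1)
    rw [Finset.prod_range_succ, ← ih, hs, Nat.factorial_succ]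
    push_cast at hc ⊢
    linear_combination (n.factorial : ℝ) * hc

theorem rSum_mul_GammaSeq_mul_rpow {d : ℝ} (hd : d < 1) (n : ℕ) :
    rSum d (n + 1) * Real.GammaSeq (1 - d) (n + 1) * ((n + 1 : ℕ) : ℝ) ^ d =
      (((n : ℝ) + 1) / (n + (1 - d))) * (((n : ℝ) + 1) / (n + (2 - d))) := by
  have hx : (0 : ℝ) < n + 1 := by positivity
  have hpow : ((n : ℝ) + 1) ^ (1 - d) * ((n : ℝ) + 1) ^ d = n + 1 := by
    rw [← Real.rpow_add hx]
    simp
  have hprod : (∏ j ∈ Finset.range n, (1 - d + (j : ℝ))) ≠ 0 :=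
    (Finset.prod_pos fun j _ => by have := j.cast_nonneg (α := ℝ); linarith).ne'
  have hn : (0 : ℝ) ≤ n := n.cast_nonneg
  have h1 : (n : ℝ) + (1 - d) ≠ 0 := by linarith
  have h2 : (n : ℝ) + (2 - d) ≠ 0 := by linarith
  have hr := rSum_succ_mul_factorial d n
  rw [Real.GammaSeq, Finset.prod_range_succ, Finset.prod_range_succ, Nat.factorial_succ]
  push_cast
  rw [show 1 - d + ((n : ℝ) + 1) = n + (2 - d) by ring, add_comm (1 - d) (n : ℝ)]
  field_simp
  linear_combination (rSum d (n + 1) * n.factorial) * hpow + ((n : ℝ) + 1) * hr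

theorem tendsto_add_div_add_atTop (a b : ℝ) :
    Tendsto (fun n : ℕ => ((n : ℝ) + a) / (n + b)) atTop (nhds 1) := by
  have hb : Tendsto (fun n : ℕ => (n : ℝ) + b) atTop atTop :=
    tendsto_atTop_add_const_right _ _ tendsto_natCast_atTop_atTop
  have h := (hb.const_div_atTop (a - b)).const_add 1
  rw [add_zero] at h
  refine h.congr' ?_
  filter_upwards [hb.eventually_ne_atTop 0] with n hn
  field_simp
  ring

theorem rSum_asymptotic (d : ℝ) (hd0 : 0 < d) (hd1 : d < 1) :
    Tendsto (fun t : ℕ => rSum d t * Real.Gamma (1 - d) * (t : ℝ) ^ d) atTop (nhds 1) := by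
  have hG : Real.Gamma (1 - d) ≠ 0 := (Real.Gamma_pos_of_pos (by linarith)).ne'
  have hseq : Tendsto (fun n : ℕ => Real.GammaSeq (1 - d) (n + 1)) atTop
      (nhds (Real.Gamma (1 - d))) :=
    (tendsto_add_atTop_iff_nat 1).2 (Real.GammaSeq_tendsto_Gamma (1 - d))
  have hratio := (tendsto_add_div_add_atTop 1 (1 - d)).mul (tendsto_add_div_add_atTop 1 (2 - d))
  have hlim := (hratio.div hseq hG).mul_const (Real.Gamma (1 - d))
  rw [one_mul, div_mul_cancel₀ _ hG] at hlim
  rw [← tendsto_add_atTop_iff_nat 1]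
  refine hlim.congr' ?_
  filter_upwards [hseq.eventually_ne hG] with n hn
  simp only [Pi.div_apply]
  rw [← rSum_mul_GammaSeq_mul_rpow hd1 n]
  field_simp
end

section
/- For 0 < d < 1/2, the sequence s_T = ∑_{t=1}^T r_t(d)² satisfies s_T ~ T^{1-2d}/((1-2d)·Γ(1-d)²) as T → ∞, i.e., (1-2d)·Γ(1-d)²·T^{2d-1}·s_T converges to 1. -/
open Filter Finset MeasureTheory ProbabilityTheory Real

theorem fracCoef_succ (d : ℝ) (n : ℕ) :
    fracCoef d (n + 1) = fracCoef d n * (((n : ℝ) - d) / ((n : ℝ) + 1)) := rfl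

theorem rSum_succ (d : ℝ) (n : ℕ) : rSum d (n + 1) = rSum d n + fracCoef d n :=
  Finset.sum_range_succ _ _

/-- The coefficient `π_{n+1}` is `-d / (n+1)` times the partial sum `r_{n+1}`. -/
theorem succ_mul_fracCoef_succ (d : ℝ) (n : ℕ) :
    ((n : ℝ) + 1) * fracCoef d (n + 1) = -d * rSum d (n + 1) := by
  induction n with
  | zero => simp [rSum, fracCoef]
  | succ n ih =>
    rw [fracCoef_succ, rSum_succ, mul_add, ← ih]
    push_cast
    field_simp
    ring

theorem prod_range_eq_factorial_mul_rSum (d : ℝ) (n : ℕ) :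
    ∏ j ∈ Finset.range n, (1 - d + j) = n.factorial * rSum d (n + 1) := by
  induction n with
  | zero => simp [rSum, fracCoef]
  | succ n ih =>
    have h := succ_mul_fracCoef_succ d n
    rw [Finset.prod_range_succ, ih, rSum_succ d (n + 1), Nat.factorial_succ]
    push_cast
    linear_combination -(n.factorial : ℝ) * h

theorem rSum_succ_mul_rpow (d : ℝ) (hd : d < 1) {n : ℕ} (hn : n ≠ 0) :
    rSum d (n + 1) * (n : ℝ) ^ d = (n / (n + (1 - d))) * (Real.GammaSeq (1 - d) n)⁻¹ := by
  have hn' : (0 : ℝ) < n := by positivity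
  have hden : (n : ℝ) + (1 - d) ≠ 0 := by linarith
  have hpow : (n : ℝ) ^ d ≠ 0 := (Real.rpow_pos_of_pos hn' d).ne'
  rw [Real.GammaSeq, Finset.prod_range_succ, prod_range_eq_factorial_mul_rSum,
    Real.rpow_sub hn', Real.rpow_one]
  have hfact : (n.factorial : ℝ) ≠ 0 := by positivity
  field_simp
  ring

theorem tendsto_rSum_succ_mul_rpow (d : ℝ) (hd : d < 1) :
    Tendsto (fun n : ℕ => rSum d (n + 1) * (n : ℝ) ^ d) atTop (nhds (Real.Gamma (1 - d))⁻¹) := by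
  have hGamma : Real.Gamma (1 - d) ≠ 0 := (Real.Gamma_pos_of_pos (by linarith)).ne'
  have h := (tendsto_natCast_div_add_atTop (1 - d)).mul
    ((Real.GammaSeq_tendsto_Gamma (1 - d)).inv₀ hGamma)
  rw [one_mul] at h
  refine h.congr' ?_
  filter_upwards [eventually_ne_atTop 0] with n hn
  exact (rSum_succ_mul_rpow d hd hn).symm

theorem tendsto_rpow_succ_sub_rpow_mul (p : ℝ) :
    Tendsto (fun n : ℕ => (((n : ℝ) + 1) ^ p - (n : ℝ) ^ p) * (n : ℝ) ^ (1 - p))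
      atTop (nhds p) := by
  have hderiv : HasDerivAt (fun x : ℝ => x ^ p) p 1 := by
    simpa using Real.hasDerivAt_rpow_const (x := 1) (p := p) (Or.inl one_ne_zero)
  have hinv : Tendsto (fun n : ℕ => (n : ℝ)⁻¹) atTop (nhdsWithin 0 {0}ᶜ) := by
    refine tendsto_nhdsWithin_iff.2 ⟨tendsto_inv_atTop_nhds_zero_nat, ?_⟩
    filter_upwards [eventually_ne_atTop 0] with n hn
    simpa using hn
  refine (hderiv.tendsto_slope_zero.comp hinv).congr' ?_
  filter_upwards [eventually_ne_atTop 0] with n hn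
  have hn' : (0 : ℝ) < n := by positivity
  have hpow : (n : ℝ) ^ p ≠ 0 := (Real.rpow_pos_of_pos hn' p).ne'
  have hadd : (1 : ℝ) + (n : ℝ)⁻¹ = (n + 1) / n := by field_simp
  simp only [Function.comp_apply, smul_eq_mul, inv_inv, Real.one_rpow]
  rw [hadd, Real.div_rpow (by positivity) hn'.le, Real.rpow_sub hn', Real.rpow_one]
  field_simp

/-- Stolz–Cesàro for sums: if `f / g → L` with `g > 0` and `∑ g → ∞`,
then the ratio of the partial sums also tends to `L`. -/
theorem tendsto_sum_range_div_sum_range {f g : ℕ → ℝ} {L : ℝ} (hg : ∀ n, 0 < g n)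
    (hsum : Tendsto (fun n => ∑ i ∈ Finset.range n, g i) atTop atTop)
    (h : Tendsto (fun n => f n / g n) atTop (nhds L)) :
    Tendsto (fun n => (∑ i ∈ Finset.range n, f i) / ∑ i ∈ Finset.range n, g i)
      atTop (nhds L) := by
  have hlittle : (fun n => f n - L * g n) =o[atTop] g := by
    rw [Asymptotics.isLittleO_iff_tendsto' (Eventually.of_forall fun n hn => absurd hn (hg n).ne')]
    refine (tendsto_sub_nhds_zero_iff.2 h).congr fun n => ?_
    have := (hg n).ne'
    field_simp
  have hdiv := (hlittle.sum_range (fun n => (hg n).le) hsum).tendsto_div_nhds_zero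
  refine tendsto_sub_nhds_zero_iff.1 (hdiv.congr' ?_)
  filter_upwards [hsum.eventually_gt_atTop 0] with n hn
  rw [Finset.sum_sub_distrib, ← Finset.mul_sum, sub_div, mul_div_cancel_right₀ _ hn.ne']

theorem sum_rSum_sq_asymptotic (d : ℝ) (hd0 : 0 < d) (hd1 : d < 1 / 2) :
    Tendsto (fun T : ℕ =>
        (1 - 2 * d) * Real.Gamma (1 - d) ^ 2 * (T : ℝ) ^ (2 * d - 1) *
          ∑ t ∈ Finset.Icc 1 T, (rSum d t) ^ 2)
      atTop (nhds 1) := by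
  set p : ℝ := 1 - 2 * d with hp
  have hp0 : 0 < p := by linarith
  have hGamma : Real.Gamma (1 - d) ≠ 0 := (Real.Gamma_pos_of_pos (by linarith)).ne'
  let g : ℕ → ℝ := fun n => ((n : ℝ) + 1) ^ p - (n : ℝ) ^ p
  have hg : ∀ n, 0 < g n := fun n =>
    sub_pos.2 (Real.rpow_lt_rpow n.cast_nonneg (lt_add_one _) hp0)
  have hgsum : ∀ n : ℕ, ∑ i ∈ Finset.range n, g i = (n : ℝ) ^ p := fun n => by
    have := Finset.sum_range_sub (fun i : ℕ => (i : ℝ) ^ p) n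
    simpa [g, Real.zero_rpow hp0.ne'] using this
  have hsum : Tendsto (fun n => ∑ i ∈ Finset.range n, g i) atTop atTop := by
    simp only [hgsum]
    exact (tendsto_rpow_atTop hp0).comp tendsto_natCast_atTop_atTop
  have hratio : Tendsto (fun n : ℕ => rSum d (n + 1) ^ 2 / g n) atTop
      (nhds ((Real.Gamma (1 - d))⁻¹ ^ 2 / p)) := by
    refine (((tendsto_rSum_succ_mul_rpow d (by linarith)).pow 2).div
      (tendsto_rpow_succ_sub_rpow_mul p) hp0.ne').congr' ?_
    filter_upwards [eventually_ne_atTop 0] with n hn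
    have hn' : (0 : ℝ) < n := by positivity
    have hpow : ((n : ℝ) ^ d) ^ 2 = (n : ℝ) ^ (1 - p) := by
      rw [← Real.rpow_mul_natCast hn'.le]
      congr 1
      push_cast
      linarith
    rw [Pi.div_apply, mul_pow, hpow, mul_div_mul_right _ _ (Real.rpow_pos_of_pos hn' _).ne']
  have hlim := (tendsto_sum_range_div_sum_range hg hsum hratio).const_mul
    (p * Real.Gamma (1 - d) ^ 2)
  have hone : p * Real.Gamma (1 - d) ^ 2 * ((Real.Gamma (1 - d))⁻¹ ^ 2 / p) = 1 := by
    field_simp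
  rw [hone] at hlim
  refine hlim.congr fun n => ?_
  have hexp : 2 * d - 1 = -p := by ring
  rw [hgsum, hexp, Real.rpow_neg n.cast_nonneg, Finset.range_eq_Ico,
    Finset.sum_Ico_add' (fun t => rSum d t ^ 2) 0 n 1]
  simp only [zero_add, Finset.Ico_add_one_right_eq_Icc]
  ring
end

section
/- Let 0 < d < 1/2 and let γ : ℕ → ℝ satisfy ∑_{h=0}^∞ |γ(h)| < ∞. Define V_T = γ(0)·∑_{t=1}^T r_t(d)² + 2·∑_{h=1}^{T-1} γ(h)·∑_{t=1}^{T-h} r_t(d) r_{t+h}(d). Then V_T / ∑_{t=1}^T r_t(d)² converges, as T → ∞, to γ(0) + 2·∑_{h=1}^∞ γ(h). -/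
open Filter Finset MeasureTheory ProbabilityTheory Real

theorem rSum_add_two (d : ℝ) (n : ℕ) :
    rSum d (n + 2) = rSum d (n + 1) * (1 - d / ((n : ℝ) + 1)) := by
  have coef : ∀ n : ℕ, fracCoef d (n + 1) = -(d / ((n : ℝ) + 1)) * rSum d (n + 1) := by
    intro n
    induction n with
    | zero => simp [rSum, fracCoef]
    | succ n ih =>
      have hsucc : rSum d (n + 2) = rSum d (n + 1) + fracCoef d (n + 1) := by
        simp only [rSum, Finset.sum_range_succ]
      have h1 : (n : ℝ) + 1 ≠ 0 := by positivity
      have h2 : (n : ℝ) + 1 + 1 ≠ 0 := by positivity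
      rw [fracCoef, hsucc, ih]
      push_cast
      field_simp
      ring
  have hsucc : rSum d (n + 2) = rSum d (n + 1) + fracCoef d (n + 1) := by
    simp only [rSum, Finset.sum_range_succ]
  rw [hsucc, coef]
  ring

theorem rSum_succ_pos {d : ℝ} (hd : d < 1) (n : ℕ) : 0 < rSum d (n + 1) := by
  induction n with
  | zero => simp [rSum, fracCoef]
  | succ n ih =>
    rw [rSum_add_two]
    have h1 : (0 : ℝ) < n + 1 := by positivity
    have : d / ((n : ℝ) + 1) < 1 := by
      rw [div_lt_one h1]
      linarith [(n.cast_nonneg : (0 : ℝ) ≤ n)]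
    exact mul_pos ih (by linarith)

theorem antitone_rSum_succ {d : ℝ} (hd0 : 0 ≤ d) (hd1 : d < 1) :
    Antitone fun n : ℕ => rSum d (n + 1) := by
  refine antitone_nat_of_succ_le fun n => ?_
  rw [rSum_add_two]
  have : 0 ≤ d / ((n : ℝ) + 1) := by positivity
  exact mul_le_of_le_one_right (rSum_succ_pos hd1 n).le (by linarith)

/-- For `d ≤ 1/2` the squared partial sums dominate a multiple of the harmonic sequence. -/
theorem inv_le_rSum_sq {d : ℝ} (hd : d ≤ 1 / 2) (n : ℕ) :
    1 / 4 * (1 / ((n : ℝ) + 1)) ≤ rSum d (n + 2) ^ 2 := by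
  induction n with
  | zero =>
    have : rSum d 2 = 1 - d := by
      simp [rSum, Finset.sum_range_succ, fracCoef]
      ring
    simp only [zero_add, this]
    norm_num
    nlinarith
  | succ n ih =>
    rw [show n + 1 + 2 = (n + 1) + 2 from rfl, rSum_add_two, mul_pow]
    push_cast
    have h1 : (0 : ℝ) < n + 1 := by positivity
    have hbase : 1 - 1 / 2 / ((n : ℝ) + 1 + 1) ≤ 1 - d / ((n : ℝ) + 1 + 1) := by gcongr
    have hpos : 0 ≤ 1 - 1 / 2 / ((n : ℝ) + 1 + 1) := by
      rw [sub_nonneg, div_le_one (by positivity)]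
      linarith
    have hsq : ((n : ℝ) + 1) / ((n : ℝ) + 1 + 1) ≤ (1 - d / ((n : ℝ) + 1 + 1)) ^ 2 := by
      refine le_trans ?_ (pow_le_pow_left₀ hpos hbase 2)
      have : ((n : ℝ) + 1) / ((n : ℝ) + 1 + 1) = 1 - 2 * (1 / 2 / ((n : ℝ) + 1 + 1)) := by
        field_simp
        ring
      rw [this]
      nlinarith [sq_nonneg (1 / 2 / ((n : ℝ) + 1 + 1))]
    calc 1 / 4 * (1 / ((n : ℝ) + 1 + 1))
        = 1 / 4 * (1 / ((n : ℝ) + 1)) * (((n : ℝ) + 1) / ((n : ℝ) + 1 + 1)) := by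
          field_simp
      _ ≤ _ := mul_le_mul ih hsq (by positivity) (by positivity)

theorem tendsto_sum_rSum_sq_atTop {d : ℝ} (hd : d ≤ 1 / 2) :
    Tendsto (fun T : ℕ => ∑ t ∈ Finset.range T, rSum d (t + 1) ^ 2) atTop atTop := by
  rw [← not_summable_iff_tendsto_nat_atTop_of_nonneg fun _ => sq_nonneg _]
  intro h
  have h' : Summable fun n : ℕ => 1 / 4 * (1 / ((n : ℝ) + 1)) :=
    Summable.of_nonneg_of_le (fun n => by positivity) (fun n => inv_le_rSum_sq hd n)
      ((summable_nat_add_iff (f := fun t => rSum d (t + 1) ^ 2) 1).mpr h)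
  rw [summable_mul_left_iff (by norm_num)] at h'
  refine Real.not_summable_one_div_natCast ((summable_nat_add_iff (f := fun n : ℕ => 1 / (n : ℝ)) 1).mp ?_)
  simpa using h'

section LaggedProducts

variable {a : ℕ → ℝ}

theorem sum_mul_lag_nonneg (ha : ∀ n, 0 ≤ a n) (h T : ℕ) :
    0 ≤ ∑ t ∈ Finset.range (T - h), a t * a (t + h) :=
  Finset.sum_nonneg fun _ _ => mul_nonneg (ha _) (ha _)

theorem sum_mul_lag_le_sum_sq (ha : ∀ n, 0 ≤ a n) (hanti : Antitone a) (h T : ℕ) :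
    ∑ t ∈ Finset.range (T - h), a t * a (t + h) ≤ ∑ t ∈ Finset.range T, a t ^ 2 :=
  calc ∑ t ∈ Finset.range (T - h), a t * a (t + h)
      ≤ ∑ t ∈ Finset.range (T - h), a t ^ 2 := Finset.sum_le_sum fun t _ => by
        rw [sq]
        exact mul_le_mul_of_nonneg_left (hanti (Nat.le_add_right t h)) (ha t)
    _ ≤ ∑ t ∈ Finset.range T, a t ^ 2 :=
        Finset.sum_le_sum_of_subset_of_nonneg (Finset.range_mono (Nat.sub_le T h))
          fun _ _ _ => sq_nonneg _

theorem sum_sq_sub_le_sum_mul_lag (ha : ∀ n, 0 ≤ a n) (hanti : Antitone a) {h T : ℕ}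
    (hT : h ≤ T) :
    ∑ t ∈ Finset.range T, a t ^ 2 - ∑ t ∈ Finset.range h, a t ^ 2 ≤
      ∑ t ∈ Finset.range (T - h), a t * a (t + h) := by
  obtain ⟨m, rfl⟩ := Nat.exists_eq_add_of_le hT
  rw [Finset.sum_range_add, add_sub_cancel_left, Nat.add_sub_cancel_left]
  refine Finset.sum_le_sum fun t _ => ?_
  rw [add_comm h t, sq]
  exact mul_le_mul_of_nonneg_right (hanti (Nat.le_add_right t h)) (ha _)

/-- If `a` is nonnegative and decreasing but not square summable, its normalised lagged products
tend to `1`. -/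
theorem tendsto_sum_mul_lag_div (ha : ∀ n, 0 ≤ a n) (hanti : Antitone a)
    (hS : Tendsto (fun T : ℕ => ∑ t ∈ Finset.range T, a t ^ 2) atTop atTop) (h : ℕ) :
    Tendsto (fun T : ℕ => (∑ t ∈ Finset.range (T - h), a t * a (t + h)) /
      ∑ t ∈ Finset.range T, a t ^ 2) atTop (nhds 1) := by
  have hlow : Tendsto (fun T : ℕ => 1 - (∑ t ∈ Finset.range h, a t ^ 2) /
      ∑ t ∈ Finset.range T, a t ^ 2) atTop (nhds 1) := by
    simpa using (tendsto_const_nhds (x := (1 : ℝ))).sub (hS.const_div_atTop _)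
  refine tendsto_of_tendsto_of_tendsto_of_le_of_le' hlow tendsto_const_nhds ?_ ?_
  · filter_upwards [hS.eventually_gt_atTop 0, eventually_ge_atTop h] with T hpos hT
    rw [one_sub_div hpos.ne']
    exact div_le_div_of_nonneg_right (sum_sq_sub_le_sum_mul_lag ha hanti hT) hpos.le
  · exact Eventually.of_forall fun T => div_le_one_of_le₀ (sum_mul_lag_le_sum_sq ha hanti h T)
      (Finset.sum_nonneg fun _ _ => sq_nonneg _)

theorem tendsto_tsum_mul_sum_mul_lag_div (ha : ∀ n, 0 ≤ a n) (hanti : Antitone a)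
    (hS : Tendsto (fun T : ℕ => ∑ t ∈ Finset.range T, a t ^ 2) atTop atTop)
    {γ : ℕ → ℝ} (hγ : Summable fun h => |γ h|) (k : ℕ) :
    Tendsto (fun T : ℕ => ∑' h, γ h * ((∑ t ∈ Finset.range (T - (h + k)), a t * a (t + (h + k))) /
      ∑ t ∈ Finset.range T, a t ^ 2)) atTop (nhds (∑' h, γ h)) := by
  refine tendsto_tsum_of_dominated_convergence hγ (fun h => ?_)
    (Eventually.of_forall fun T h => ?_)
  · simpa using (tendsto_sum_mul_lag_div ha hanti hS (h + k)).const_mul (γ h)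
  · have hnn : 0 ≤ ∑ t ∈ Finset.range T, a t ^ 2 := Finset.sum_nonneg fun _ _ => sq_nonneg _
    rw [Real.norm_eq_abs, abs_mul, abs_of_nonneg (div_nonneg (sum_mul_lag_nonneg ha _ _) hnn)]
    exact mul_le_of_le_one_right (abs_nonneg _)
      (div_le_one_of_le₀ (sum_mul_lag_le_sum_sq ha hanti _ T) hnn)

end LaggedProducts

theorem sum_Icc_one_eq_sum_range (f : ℕ → ℝ) (n : ℕ) :
    ∑ t ∈ Finset.Icc 1 n, f t = ∑ t ∈ Finset.range n, f (t + 1) := by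
  rw [Finset.range_eq_Ico, Finset.sum_Ico_add' f 0 n 1]
  rfl

theorem weighted_variance_ratio_limit (d : ℝ) (hd0 : 0 < d) (hd1 : d < 1 / 2)
    (γ : ℕ → ℝ) (hγ : Summable (fun h : ℕ => |γ h|)) :
    Tendsto (fun T : ℕ =>
        (γ 0 * ∑ t ∈ Finset.Icc 1 T, (rSum d t) ^ 2 +
          2 * ∑ h ∈ Finset.Icc 1 (T - 1), γ h * ∑ t ∈ Finset.Icc 1 (T - h), rSum d t * rSum d (t + h)) /
        (∑ t ∈ Finset.Icc 1 T, (rSum d t) ^ 2))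
      atTop (nhds (γ 0 + 2 * ∑' h : ℕ, γ (h + 1))) := by
  have hd1' : d < 1 := by linarith
  have hS := tendsto_sum_rSum_sq_atTop hd1.le
  have hγ1 : Summable fun h : ℕ => |γ (h + 1)| := (summable_nat_add_iff 1).mpr hγ
  have hlim := ((tendsto_tsum_mul_sum_mul_lag_div (fun n => (rSum_succ_pos hd1' n).le)
    (antitone_rSum_succ hd0.le hd1') hS hγ1 1).const_mul 2).const_add (γ 0)
  refine hlim.congr' ?_
  filter_upwards [hS.eventually_gt_atTop 0] with T hpos
  simp only [sum_Icc_one_eq_sum_range]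
  rw [add_div, mul_div_cancel_right₀ _ hpos.ne', mul_div_assoc, Finset.sum_div,
    tsum_eq_sum (s := Finset.range (T - 1))]
  · congr 2
    refine Finset.sum_congr rfl fun h _ => ?_
    rw [mul_div_assoc]
    simp only [add_right_comm _ 1 (h + 1)]
  · intro h hh
    have : T - (h + 1) = 0 := by
      rw [Finset.mem_range] at hh
      omega
    simp [this]
end
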